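/- (Disjunctive source coding theorem) Let X be a hyperconfusion over a finite probability space (Ω, p) with supp(p) ⊆ supp(X), and for each n let X₁,…,Xₙ be its n-fold i.i.d. hyperconfusion sequence over (Ωⁿ, p^⊗ⁿ). Then lim_{n→∞} H(∪_{i=1}^n Xᵢ) = H∞(X). -/

import Mathlib

open Finset
open scoped Classical ENNReal

noncomputable section

variable {Ω : Type*}

/-- `X` is a confusion hypergraph (hyperconfusion) over `Ω`: a nonempty,
downward-closed family of subsets of `Ω`. -/
def IsHyp (X : Finset (Finset Ω)) : Prop :=
  X.Nonempty ∧ ∀ A ∈ X, ∀ B ⊆ A, B ∈ X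

/-- `p` is a probability mass function on the finite type `Ω`. -/
def IsPMF [Fintype Ω] (p : Ω → ℝ) : Prop :=
  (∀ ω, 0 ≤ p ω) ∧ ∑ ω : Ω, p ω = 1

/-- The probability of a set `A` under the pmf `p`. -/
def pset (p : Ω → ℝ) (A : Finset Ω) : ℝ := ∑ ω ∈ A, p ω

/-- A valid conditional pmf `k` from `Ω` to (pmfs on) `X`: nonnegative, sums to one,
supported on `X`, and `k A z > 0` with `p z > 0` implies `z ∈ A`. -/
def ValidK [Fintype Ω] (p : Ω → ℝ) (X : Finset (Finset Ω)) (k : Ω → Finset Ω → ℝ) : Prop :=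
  (∀ z A, 0 ≤ k z A) ∧ (∀ z, ∑ A : Finset Ω, k z A = 1) ∧
    (∀ z A, 0 < k z A → A ∈ X) ∧ ∀ z A, 0 < p z → 0 < k z A → z ∈ A

/-- The mutual information `I(Z;A)` where `Z ∼ p` and `A | Z ∼ k`. -/
def MI [Fintype Ω] (p : Ω → ℝ) (k : Ω → Finset Ω → ℝ) : ℝ :=
  ∑ z : Ω, ∑ A : Finset Ω,
    p z * k z A * Real.logb 2 (k z A / ∑ z' : Ω, p z' * k z' A)

/-- The entropy `H(X)` of a hyperconfusion `X` over `(Ω, p)`, valued in `[0,∞]`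
(`∞` when no valid conditional pmf exists). -/
def Hent [Fintype Ω] (p : Ω → ℝ) (X : Finset (Finset Ω)) : ℝ≥0∞ :=
  ⨅ (k : Ω → Finset Ω → ℝ) (_ : ValidK p X k), ENNReal.ofReal (MI p k)

/-- `−log₂ x = log₂ (1/x)`, valued in `[0,∞]` (equals `∞` when `x ≤ 0`). -/
def negLog2 (x : ℝ) : ℝ≥0∞ :=
  if x ≤ 0 then ⊤ else ENNReal.ofReal (Real.logb 2 x⁻¹)

/-- The min-entropy `H∞(X) = −log₂ max_{A ∈ X} p(A)`. -/
def Hmin [Fintype Ω] (p : Ω → ℝ) (X : Finset (Finset Ω)) : ℝ≥0∞ :=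
  ⨅ A ∈ X, negLog2 (pset p A)

/-- The integral max-entropy `H₀(X)`: `log₂` of the minimum cardinality of a subfamily
of `X` covering `supp(p)` (`∞` if there is none). -/
def H0ent [Fintype Ω] (p : Ω → ℝ) (X : Finset (Finset Ω)) : ℝ≥0∞ :=
  ⨅ (S : Finset (Finset Ω))
    (_ : S ⊆ X ∧ ∀ ω : Ω, 0 < p ω → ∃ A ∈ S, ω ∈ A),
    ENNReal.ofReal (Real.logb 2 (S.card : ℝ))

/-- The fractional max-entropy `Hε(X)`: `log₂` of the minimum total weight of a
fractional covering of `supp(p)` by members of `X` (`∞` if there is none). -/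
def Heps [Fintype Ω] (p : Ω → ℝ) (X : Finset (Finset Ω)) : ℝ≥0∞ :=
  ⨅ (μ : Finset Ω → ℝ)
    (_ : (∀ A, 0 ≤ μ A) ∧ (∀ A, μ A ≠ 0 → A ∈ X) ∧
      ∀ ω : Ω, 0 < p ω → 1 ≤ ∑ A ∈ X, if ω ∈ A then μ A else 0),
    ENNReal.ofReal (Real.logb 2 (∑ A ∈ X, μ A))

/-- The support of the pmf `p`. -/
def suppP [Fintype Ω] (p : Ω → ℝ) : Finset Ω := univ.filter fun ω => 0 < p ω

/-- The support of a hyperconfusion: the points whose singleton is confusable. -/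
def suppH [Fintype Ω] (X : Finset (Finset Ω)) : Finset Ω :=
  univ.filter fun ω => ({ω} : Finset Ω) ∈ X

/-- `X` is an ordinary information: the union of the powersets of a nonempty collection
of pairwise disjoint subsets of `Ω`. -/
def IsOI (X : Finset (Finset Ω)) : Prop :=
  ∃ S : Finset (Finset Ω), S.Nonempty ∧
    (∀ A ∈ S, ∀ B ∈ S, A ≠ B → Disjoint A B) ∧
    ∀ C : Finset Ω, C ∈ X ↔ ∃ A ∈ S, C ⊆ A

/-- The Heyting implication `X → Y := {A ⊆ Ω : X ∩ 2^A ⊆ Y}` of hyperconfusions. -/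
def himpHyp [Fintype Ω] (X Y : Finset (Finset Ω)) : Finset (Finset Ω) :=
  univ.filter fun A => ∀ B ∈ X, B ⊆ A → B ∈ Y

/-- `log₂` on `[0,∞]`. -/
def elog2 (x : ℝ≥0∞) : ℝ≥0∞ :=
  if x = ⊤ then ⊤ else ENNReal.ofReal (Real.logb 2 x.toReal)

/-- The maximal members of a hyperconfusion (under inclusion). -/
def maxsHyp (X : Finset (Finset Ω)) : Finset (Finset Ω) :=
  X.filter fun A => ∀ B ∈ X, A ⊆ B → B = A

/-- The indicator vector of `A ⊆ Ω`, as an element of `ℝ^Ω`. -/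
def indVec (A : Finset Ω) : Ω → ℝ := fun ω => if ω ∈ A then 1 else 0

/-- The ordinary information `oi(f) = {A : |f(A)| ≤ 1}` induced by a function `f`. -/
def oiF {Ω' : Type*} [Fintype Ω] (f : Ω → Ω') : Finset (Finset Ω) :=
  univ.filter fun A : Finset Ω => (A.image f).card ≤ 1

/-- Independence of two hyperconfusions: all unions of maximal confusable sets are
independent events. -/
def IndepHyp [Fintype Ω] (p : Ω → ℝ) (X Y : Finset (Finset Ω)) : Prop :=
  ∀ S ⊆ maxsHyp X, ∀ T ⊆ maxsHyp Y,
    pset p ((S.biUnion id) ∩ (T.biUnion id)) =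
      pset p (S.biUnion id) * pset p (T.biUnion id)

/-- The embedding `Xᵢ` of a hyperconfusion `X` over `Ω` into the product space `Ωⁿ`
along coordinate `i`. -/
def embedHyp [Fintype Ω] (X : Finset (Finset Ω)) (n : ℕ) (i : Fin n) :
    Finset (Finset (Fin n → Ω)) :=
  univ.filter fun C => ∃ A ∈ X, ∀ ω ∈ C, ω i ∈ A

/-- The i.i.d. product pmf `p^⊗ⁿ` on `Ωⁿ`. -/
def pPow [Fintype Ω] (p : Ω → ℝ) (n : ℕ) : (Fin n → Ω) → ℝ :=
  fun ω => ∏ i, p (ω i)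

/-- The conditional pmf `p(·|E)` (supported on `E`). -/
def condP [Fintype Ω] (p : Ω → ℝ) (E : Finset Ω) : Ω → ℝ :=
  fun ω => if ω ∈ E then p ω / pset p E else 0

/-- The conditional entropy `H(X|E)` of the hyperconfusion `X ∩ 2^E` over the
conditional probability space `(E, p(·|E))`. -/
def HcondEvent [Fintype Ω] (p : Ω → ℝ) (X : Finset (Finset Ω)) (E : Finset Ω) : ℝ≥0∞ :=
  Hent (condP p E) (X ∩ E.powerset)

/-- The conditional entropy `H(X|Y) := p(E)·(H(X∩Y|E) − H(Y|E))` where `E = supp(Y)`,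
taken to be `0` when `p(E) = 0`. -/
def Hcond [Fintype Ω] (p : Ω → ℝ) (X Y : Finset (Finset Ω)) : ℝ≥0∞ :=
  if pset p (suppH Y) = 0 then 0
  else ENNReal.ofReal (pset p (suppH Y)) *
    (HcondEvent p (X ∩ Y) (suppH Y) - HcondEvent p Y (suppH Y))

/-- The singleton hyperconfusion `sing(Ω) = {∅} ∪ {{ω} : ω ∈ Ω}`. -/
def singHyp (α : Type*) [Fintype α] : Finset (Finset α) :=
  insert ∅ (univ.image fun ω : α => ({ω} : Finset α))

/-- A valid pmf `q` on `Ỹ` for the coarse entropy: supported on `Yt`, and dominating `p`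
in the sense that `p(S) ≤ Σ_{B ∈ Yt, S∩B ≠ ∅} q(B)` for all `S`. -/
def ValidQ [Fintype Ω] (p : Ω → ℝ) (Yt : Finset (Finset Ω)) (q : Finset Ω → ℝ) : Prop :=
  (∀ B, 0 ≤ q B) ∧ (∀ B, q B ≠ 0 → B ∈ Yt) ∧ (∑ B : Finset Ω, q B = 1) ∧
    ∀ S : Finset Ω, pset p S ≤ ∑ B ∈ Yt, if (S ∩ B).Nonempty then q B else 0

/-- A valid conditional pmf `m` from `Ỹ` to `X` for the coarse entropy:
`m A B > 0` with `q B > 0` implies `B ⊆ A`. -/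
def ValidM [Fintype Ω] (X : Finset (Finset Ω)) (q : Finset Ω → ℝ)
    (m : Finset Ω → Finset Ω → ℝ) : Prop :=
  (∀ B A, 0 ≤ m B A) ∧ (∀ B, ∑ A : Finset Ω, m B A = 1) ∧
    (∀ B A, 0 < m B A → A ∈ X) ∧ ∀ B A, 0 < q B → 0 < m B A → B ⊆ A

/-- The mutual information `I(B;A)` where `B ∼ q` and `A | B ∼ m`. -/
def MI2 [Fintype Ω] (q : Finset Ω → ℝ) (m : Finset Ω → Finset Ω → ℝ) : ℝ :=
  ∑ B : Finset Ω, ∑ A : Finset Ω,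
    q B * m B A * Real.logb 2 (m B A / ∑ B' : Finset Ω, q B' * m B' A)

/-- The coarse entropy `H(X ↘ Y)` of `X` with respect to `Y`. -/
def Hcoarse [Fintype Ω] (p : Ω → ℝ) (X Y : Finset (Finset Ω)) : ℝ≥0∞ :=
  if Y ∪ singHyp Ω ⊆ X then
    ⨆ (q : Finset Ω → ℝ) (_ : ValidQ p (Y ∪ singHyp Ω) q),
      ⨅ (m : Finset Ω → Finset Ω → ℝ) (_ : ValidM X q m), ENNReal.ofReal (MI2 q m)
  else ⊤

/-- The capacity `C(X) = max_p H(X)` of a hyperconfusion. -/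
def capacity [Fintype Ω] (X : Finset (Finset Ω)) : ℝ≥0∞ :=
  ⨆ (p : Ω → ℝ) (_ : IsPMF p), Hent p X

/-- The product hyperconfusion `X ⊗ Y` over `Ω × Γ`. -/
def prodHyp {Γ : Type*} [Fintype Ω] [Fintype Γ]
    (X : Finset (Finset Ω)) (Y : Finset (Finset Γ)) : Finset (Finset (Ω × Γ)) :=
  univ.filter fun C => ∃ A ∈ X, ∃ B ∈ Y, ∀ c ∈ C, c.1 ∈ A ∧ c.2 ∈ B

/-- The `n`-fold product hyperconfusion `X^⊗ⁿ` over `Ωⁿ`. -/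
def powHyp [Fintype Ω] (X : Finset (Finset Ω)) (n : ℕ) : Finset (Finset (Fin n → Ω)) :=
  univ.filter fun C => ∃ A : Fin n → Finset Ω, (∀ i, A i ∈ X) ∧ ∀ ω ∈ C, ∀ i, ω i ∈ A i

/-- `X ⊑ Y`: there is a surjective hyperconfusable set-valued function from `(Ω,X)`
to `(Γ,Y)`. -/
def ConfusesOnto {Γ : Type*} [Fintype Ω] [Fintype Γ]
    (X : Finset (Finset Ω)) (Y : Finset (Finset Γ)) : Prop :=
  ∃ β : Ω → Finset Γ, (∀ A ∈ X, A.biUnion β ∈ Y) ∧ univ.biUnion β = univ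

/-- The confusion ratio `CR(X/Y) = sup{m/n : X^⊗ⁿ ⊑ Y^⊗ᵐ}`. -/
def confRatio {Γ : Type*} [Fintype Ω] [Fintype Γ]
    (X : Finset (Finset Ω)) (Y : Finset (Finset Γ)) : ℝ≥0∞ :=
  ⨆ (n : ℕ) (m : ℕ)
    (_ : 0 < n ∧ 0 < m ∧ ConfusesOnto (powHyp X n) (powHyp Y m)),
    (m : ℝ≥0∞) / (n : ℝ≥0∞)

/-- Lower bound: if every member of `Y` has probability at most `M`, the mutual
information of every valid kernel is at least `log (1/M)`. -/
lemma aux_lower [Fintype Ω] (p : Ω → ℝ) (hp : IsPMF p) (Y : Finset (Finset Ω)) (M : ℝ)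
    (hM : 0 < M) (hY : ∀ C ∈ Y, pset p C ≤ M) (k : Ω → Finset Ω → ℝ) (hk : ValidK p Y k) :
    Real.logb 2 M⁻¹ ≤ MI p k := by
  obtain ⟨hk0, hk1, hkY, hkm⟩ := hk
  set q : Finset Ω → ℝ := fun A => ∑ z' : Ω, p z' * k z' A with hq
  have hq0 : ∀ A, 0 ≤ q A := fun A => Finset.sum_nonneg fun z _ => mul_nonneg (hp.1 z) (hk0 z A)
  have hpq : ∀ z A, p z * k z A ≤ q A := fun z A =>
    Finset.single_le_sum (f := fun z => p z * k z A)
      (fun z _ => mul_nonneg (hp.1 z) (hk0 z A)) (Finset.mem_univ z)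
  have hl2 : 0 < Real.log 2 := Real.log_pos (by norm_num)
  have hone : ∑ z : Ω, ∑ A : Finset Ω, p z * k z A = 1 := by
    simp_rw [← Finset.mul_sum, hk1, mul_one]; exact hp.2
  have hqone : ∑ A : Finset Ω, q A = 1 := by
    rw [← hone, Finset.sum_comm]
  have key : ∀ z A, p z * k z A * Real.log M⁻¹ +
      (p z * k z A - (if A ∈ Y ∧ z ∈ A then p z * q A / M else 0))
        ≤ p z * k z A * Real.log (k z A / q A) := by
    intro z A
    rcases (mul_nonneg (hp.1 z) (hk0 z A)).eq_or_lt with h | h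
    · rw [← h]
      have : 0 ≤ (if A ∈ Y ∧ z ∈ A then p z * q A / M else 0) := by
        split_ifs
        · exact div_nonneg (mul_nonneg (hp.1 z) (hq0 A)) hM.le
        · exact le_rfl
      linarith
    · have hpz : 0 < p z := lt_of_le_of_ne (hp.1 z) (by rintro h'; simp [← h'] at h)
      have hkz : 0 < k z A := lt_of_le_of_ne (hk0 z A) (by rintro h'; simp [← h'] at h)
      have hqA : 0 < q A := h.trans_le (hpq z A)
      rw [if_pos ⟨hkY z A hkz, hkm z A hpz hkz⟩]
      have h1 := Real.one_sub_inv_le_log_of_pos (x := k z A * M / q A) (by positivity)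
      have h2 : Real.log (k z A * M / q A) = Real.log (k z A / q A) - Real.log M⁻¹ := by
        rw [← Real.log_div (by positivity) (by positivity)]
        congr 1; field_simp
      rw [h2] at h1
      have h3 := mul_le_mul_of_nonneg_left h1 h.le
      have h4 : p z * k z A * (1 - (k z A * M / q A)⁻¹) = p z * k z A - p z * q A / M := by
        field_simp
      rw [h4] at h3
      linarith
  have hsum := Finset.sum_le_sum fun z (_ : z ∈ Finset.univ) =>
    Finset.sum_le_sum fun A (_ : A ∈ Finset.univ) => key z A
  simp_rw [Finset.sum_add_distrib, Finset.sum_sub_distrib, ← Finset.sum_mul, hone] at hsum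
  have hB : ∑ z : Ω, ∑ A : Finset Ω, (if A ∈ Y ∧ z ∈ A then p z * q A / M else 0) ≤ 1 := by
    rw [Finset.sum_comm, ← hqone]
    refine Finset.sum_le_sum fun A _ => ?_
    by_cases hA : A ∈ Y
    · have : ∑ z : Ω, (if A ∈ Y ∧ z ∈ A then p z * q A / M else 0) = pset p A * (q A / M) := by
        simp only [hA, true_and]
        rw [pset, Finset.sum_mul, ← Finset.sum_filter]
        refine Finset.sum_congr (by ext; simp) fun z _ => by ring
      rw [this]
      calc pset p A * (q A / M) ≤ M * (q A / M) :=
            mul_le_mul_of_nonneg_right (hY A hA) (div_nonneg (hq0 A) hM.le)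
        _ = q A := by field_simp
    · simp [hA, hq0 A]
  have hMI : MI p k = (∑ z : Ω, ∑ A : Finset Ω, p z * k z A * Real.log (k z A / q A))
      / Real.log 2 := by
    simp_rw [MI, Real.logb, Finset.sum_div, hq, mul_div_assoc]
  rw [hMI, Real.logb]
  apply div_le_div_of_nonneg_right _ hl2.le
  linarith

/-- Upper bound on the entropy from a labelled kernel `κ` and a reference weight `r`. -/
lemma aux_upper {L : Type*} [Fintype L] [Fintype Ω] (p : Ω → ℝ) (hp : IsPMF p)
    (Y : Finset (Finset Ω)) (s : L → Finset Ω) (hs : ∀ l, s l ∈ Y)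
    (κ : Ω → L → ℝ) (hκ0 : ∀ z l, 0 ≤ κ z l) (hκ1 : ∀ z, ∑ l, κ z l = 1)
    (hκs : ∀ z l, 0 < p z → 0 < κ z l → z ∈ s l)
    (r : L → ℝ) (hr0 : ∀ l, 0 < r l) (hr1 : ∑ l, r l ≤ 1) :
    Hent p Y ≤ ENNReal.ofReal
      ((∑ z, ∑ l, p z * κ z l * Real.log (κ z l / r l)) / Real.log 2) := by
  have hl2 : 0 < Real.log 2 := Real.log_pos (by norm_num)
  set k : Ω → Finset Ω → ℝ := fun z A => ∑ l, if s l = A then κ z l else 0 with hk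
  have hk0 : ∀ z A, 0 ≤ k z A := fun z A => Finset.sum_nonneg fun l _ => by
    split_ifs
    · exact hκ0 z l
    · exact le_rfl
  have hex : ∀ z A, 0 < k z A → ∃ l, s l = A ∧ 0 < κ z l := by
    intro z A h
    obtain ⟨l, -, hl⟩ := Finset.exists_lt_of_sum_lt (s := Finset.univ) (f := fun _ : L => (0:ℝ))
      (g := fun l => if s l = A then κ z l else 0) (by simpa using h)
    by_cases h' : s l = A
    · exact ⟨l, h', by simpa [h'] using hl⟩
    · simp [h'] at hl
  have hswap : ∀ (z : Ω) (g : Finset Ω → ℝ),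
      ∑ A : Finset Ω, k z A * g A = ∑ l, κ z l * g (s l) := by
    intro z g
    simp_rw [hk, Finset.sum_mul]
    rw [Finset.sum_comm]
    refine Finset.sum_congr rfl fun l _ => ?_
    simp [ite_mul]
  have hvalid : ValidK p Y k := by
    refine ⟨hk0, fun z => ?_, fun z A h => ?_, fun z A hz h => ?_⟩
    · have := hswap z (fun _ => 1)
      simp only [mul_one] at this
      rw [this, hκ1]
    · obtain ⟨l, rfl, -⟩ := hex z A h
      exact hs l
    · obtain ⟨l, rfl, hl⟩ := hex z A h
      exact hκs z l hz hl
  refine (iInf₂_le k hvalid).trans (ENNReal.ofReal_le_ofReal ?_)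
  set q : Finset Ω → ℝ := fun A => ∑ z' : Ω, p z' * k z' A with hq
  have hq0 : ∀ A, 0 ≤ q A := fun A => Finset.sum_nonneg fun z _ => mul_nonneg (hp.1 z) (hk0 z A)
  have hpq : ∀ z A, p z * k z A ≤ q A := fun z A =>
    Finset.single_le_sum (f := fun z => p z * k z A)
      (fun z _ => mul_nonneg (hp.1 z) (hk0 z A)) (Finset.mem_univ z)
  have hκk : ∀ z l, κ z l ≤ k z (s l) := by
    intro z l
    have := Finset.single_le_sum (f := fun l' => if s l' = s l then κ z l' else 0)
      (fun l' _ => by split_ifs; exacts [hκ0 z l', le_rfl]) (Finset.mem_univ l)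
    simpa using this
  have hMI : MI p k = (∑ z : Ω, ∑ l, p z * κ z l * Real.log (k z (s l) / q (s l)))
      / Real.log 2 := by
    rw [MI, Finset.sum_div]
    refine Finset.sum_congr rfl fun z _ => ?_
    have := hswap z (fun A => Real.log (k z A / q A))
    simp_rw [mul_assoc, ← Finset.mul_sum, Real.logb, ← mul_div_assoc, ← Finset.sum_div]
    rw [← mul_div_assoc, ← this]
  rw [hMI]
  apply div_le_div_of_nonneg_right _ hl2.le
  have key : ∀ z l, p z * κ z l * Real.log (k z (s l) / q (s l)) ≤
      p z * κ z l * Real.log (κ z l / r l) +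
        (p z * k z (s l) * (r l / q (s l)) - p z * κ z l) := by
    intro z l
    rcases (mul_nonneg (hp.1 z) (hκ0 z l)).eq_or_lt with h | h
    · rw [← h]
      have : 0 ≤ p z * k z (s l) * (r l / q (s l)) :=
        mul_nonneg (mul_nonneg (hp.1 z) (hk0 _ _)) (div_nonneg (hr0 l).le (hq0 _))
      linarith
    · have hpz : 0 < p z := lt_of_le_of_ne (hp.1 z) (by rintro h'; simp [← h'] at h)
      have hkz : 0 < κ z l := lt_of_le_of_ne (hκ0 z l) (by rintro h'; simp [← h'] at h)
      have hk' : 0 < k z (s l) := hkz.trans_le (hκk z l)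
      have hqA : 0 < q (s l) := (mul_pos hpz hk').trans_le (hpq z _)
      have hr := hr0 l
      have h1 := Real.log_le_sub_one_of_pos (x := (k z (s l) / q (s l)) / (κ z l / r l))
        (by positivity)
      rw [Real.log_div (by positivity) (by positivity)] at h1
      have h3 := mul_le_mul_of_nonneg_left h1 h.le
      have h4 : p z * κ z l * ((k z (s l) / q (s l)) / (κ z l / r l) - 1) =
          p z * k z (s l) * (r l / q (s l)) - p z * κ z l := by
        field_simp
      rw [h4] at h3
      linarith
  have hsum := Finset.sum_le_sum fun z (_ : z ∈ Finset.univ) =>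
    Finset.sum_le_sum fun l (_ : l ∈ Finset.univ) => key z l
  simp_rw [Finset.sum_add_distrib, Finset.sum_sub_distrib] at hsum
  have hone : ∑ z : Ω, ∑ l, p z * κ z l = 1 := by
    simp_rw [← Finset.mul_sum, hκ1, mul_one]; exact hp.2
  have hB : ∑ z : Ω, ∑ l, p z * k z (s l) * (r l / q (s l)) ≤ 1 := by
    rw [Finset.sum_comm]
    refine le_trans (Finset.sum_le_sum fun l _ => ?_) hr1
    rw [← Finset.sum_mul]
    change q (s l) * (r l / q (s l)) ≤ r l
    rcases (hq0 (s l)).eq_or_lt with h | h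
    · rw [← h]; simpa using (hr0 l).le
    · exact le_of_eq (by field_simp)
  linarith

lemma aux_pPow [Fintype Ω] (p : Ω → ℝ) (hp : IsPMF p) (n : ℕ) : IsPMF (pPow p n) := by
  refine ⟨fun z => Finset.prod_nonneg fun i _ => hp.1 _, ?_⟩
  have := Finset.prod_univ_sum (fun _ : Fin n => (Finset.univ : Finset Ω)) (fun _ ω => p ω)
  rw [Fintype.piFinset_univ] at this
  simp only [pPow]
  rw [← this]
  simp [hp.2]

/-- number of coordinates lying in `A` -/
def cnt (A : Finset Ω) (n : ℕ) (z : Fin n → Ω) : ℕ :=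
  (Finset.univ.filter fun i => z i ∈ A).card

lemma aux_gen [Fintype Ω] (p : Ω → ℝ) (hp : IsPMF p) (A : Finset Ω) (n : ℕ) (t : ℝ) :
    ∑ z : Fin n → Ω, pPow p n z * t ^ cnt A n z = (pset p A * t + (1 - pset p A)) ^ n := by
  have h1 : ∑ ω, p ω * (if ω ∈ A then t else 1) = pset p A * t + (1 - pset p A) := by
    have : ∀ ω, p ω * (if ω ∈ A then t else 1) = (if ω ∈ A then p ω else 0) * (t - 1) + p ω := by
      intro ω; split_ifs <;> ring
    simp_rw [this, Finset.sum_add_distrib, ← Finset.sum_mul, hp.2]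
    rw [← Finset.sum_filter, pset]
    simp
    ring
  have := Finset.prod_univ_sum (fun _ : Fin n => (Finset.univ : Finset Ω))
    (fun _ ω => p ω * (if ω ∈ A then t else 1))
  rw [Fintype.piFinset_univ] at this
  simp only [h1, Finset.prod_const, Finset.card_univ, Fintype.card_fin] at this
  rw [this]
  refine Finset.sum_congr rfl fun z _ => ?_
  rw [Finset.prod_mul_distrib, pPow, cnt, Finset.prod_ite]
  simp

lemma aux_exp [Fintype Ω] (p : Ω → ℝ) (hp : IsPMF p) (A : Finset Ω) (hA : 0 < pset p A)
    (n : ℕ) :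
    ∑ z : Fin n → Ω, pPow p n z * (1 / ((cnt A n z : ℝ) + 1)) ≤ 1 / ((n + 1) * pset p A) := by
  have hm1 : pset p A ≤ 1 := by
    rw [← hp.2]
    exact Finset.sum_le_sum_of_subset_of_nonneg (Finset.subset_univ _) fun _ _ _ => hp.1 _
  have h1 : ∫ t in (0:ℝ)..1, ∑ z : Fin n → Ω, pPow p n z * t ^ cnt A n z =
      ∑ z : Fin n → Ω, pPow p n z * (1 / ((cnt A n z : ℝ) + 1)) := by
    rw [intervalIntegral.integral_finsetSum]
    · refine Finset.sum_congr rfl fun z _ => ?_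
      rw [intervalIntegral.integral_const_mul, integral_pow]
      simp
    · intro z _
      exact Continuous.intervalIntegrable (by fun_prop) _ _
  rw [← h1]
  simp_rw [aux_gen p hp A n]
  rw [intervalIntegral.integral_comp_mul_add (fun x => x ^ n) hA.ne', integral_pow]
  have : 0 ≤ (1 - pset p A) ^ (n+1) := pow_nonneg (by linarith) _
  simp only [mul_one, mul_zero, zero_add, smul_eq_mul, add_sub_cancel, one_pow]
  rw [← div_eq_inv_mul, div_div]
  gcongr
  linarith

lemma aux_main [Fintype Ω] (p : Ω → ℝ) (hp : IsPMF p) (X : Finset (Finset Ω)) (hX : IsHyp X)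
    (hsupp : ∀ ω : Ω, 0 < p ω → ({ω} : Finset Ω) ∈ X) (A : Finset Ω) (hAX : A ∈ X)
    (hA : 0 < pset p A) (n : ℕ) (hn : 0 < n) :
    Hent (pPow p n) (Finset.univ.sup fun i : Fin n => embedHyp X n i) ≤
      ENNReal.ofReal (Real.logb 2 (pset p A)⁻¹ +
        Real.logb 2 (Fintype.card Ω) / (pset p A) * (1 / ((n:ℝ) + 1))) := by
  have hl2 : 0 < Real.log 2 := Real.log_pos (by norm_num)
  have hpn := aux_pPow p hp n
  have hne : Nonempty Ω := by
    by_contra h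
    rw [not_nonempty_iff] at h
    have := hp.2
    simp at this
  have hcard : 0 < (Fintype.card Ω : ℝ) := by exact_mod_cast Fintype.card_pos
  have hcard1 : 1 ≤ (Fintype.card Ω : ℝ) := by exact_mod_cast Fintype.card_pos
  have hmem : ∀ (C : Finset (Fin n → Ω)) (i : Fin n), C ∈ embedHyp X n i →
      C ∈ Finset.univ.sup fun i : Fin n => embedHyp X n i := fun C i h =>
    Finset.mem_sup.2 ⟨i, Finset.mem_univ _, h⟩
  let i0 : Fin n := ⟨0, hn⟩
  let s : Fin n ⊕ Ω → Finset (Fin n → Ω) := Sum.elim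
    (fun i => Finset.univ.filter fun z => z i ∈ A)
    (fun ω => if ({ω} : Finset Ω) ∈ X then Finset.univ.filter fun z => z i0 = ω else ∅)
  let κ : (Fin n → Ω) → Fin n ⊕ Ω → ℝ := fun z => Sum.elim
    (fun i => if z i ∈ A then 1 / ((cnt A n z : ℝ) + 1) else 0)
    (fun ω => if z i0 = ω then 1 / ((cnt A n z : ℝ) + 1) else 0)
  let r : Fin n ⊕ Ω → ℝ := Sum.elim (fun _ => 1 / ((n : ℝ) + 1))
    (fun _ => 1 / (((n : ℝ) + 1) * Fintype.card Ω))
  have hU := aux_upper (pPow p n) hpn (Finset.univ.sup fun i : Fin n => embedHyp X n i) s ?_ κ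
    ?_ ?_ ?_ r ?_ ?_
  · refine hU.trans (ENNReal.ofReal_le_ofReal ?_)
    rw [div_le_iff₀ hl2]
    set m := pset p A with hm
    set N := (n : ℝ) + 1 with hN
    have hN0 : 0 < N := by positivity
    set e : (Fin n → Ω) → ℝ := fun z => 1 / ((cnt A n z : ℝ) + 1) with he
    have he0 : ∀ z, 0 < e z := fun z => by positivity
    have hz : ∀ z, ∑ l, pPow p n z * κ z l * Real.log (κ z l / r l) =
        pPow p n z * (Real.log (e z * N) + e z * Real.log (Fintype.card Ω)) := by
      intro z
      rw [Fintype.sum_sum_type]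
      have a1 : ∑ i, pPow p n z * κ z (Sum.inl i) * Real.log (κ z (Sum.inl i) / r (Sum.inl i)) =
          pPow p n z * ((cnt A n z : ℝ) * (e z * Real.log (e z * N))) := by
        have : ∀ i, pPow p n z * κ z (Sum.inl i) * Real.log (κ z (Sum.inl i) / r (Sum.inl i)) =
            if z i ∈ A then pPow p n z * (e z * Real.log (e z * N)) else 0 := by
          intro i
          by_cases h : z i ∈ A
          · simp only [κ, r, Sum.elim_inl, h, if_true, he]
            simp only [div_div_eq_mul_div, div_one, mul_assoc, hN]
          · simp [κ, h]
        simp_rw [this]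
        rw [← Finset.sum_filter, Finset.sum_const, nsmul_eq_mul, cnt]
        ring
      have a2 : ∑ ω, pPow p n z * κ z (Sum.inr ω) * Real.log (κ z (Sum.inr ω) / r (Sum.inr ω)) =
          pPow p n z * (e z * (Real.log (e z * N) + Real.log (Fintype.card Ω))) := by
        rw [Finset.sum_eq_single (z i0)]
        · simp only [κ, r, Sum.elim_inr, if_true]
          rw [← Real.log_mul (mul_pos (he0 z) hN0).ne' hcard.ne']
          simp only [he, div_div_eq_mul_div, div_one, mul_assoc, hN]
        · intro ω _ h
          simp [κ, h.symm]
        · simp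
      rw [a1, a2]
      have : (cnt A n z : ℝ) * e z + e z = 1 := by simp only [he]; field_simp
      linear_combination (pPow p n z * Real.log (e z * N)) * this
    simp_rw [hz]
    have hE : ∑ z, pPow p n z * e z ≤ 1 / (N * m) := aux_exp p hp A hA n
    have hpt : ∀ z, pPow p n z * (Real.log (e z * N) + e z * Real.log (Fintype.card Ω)) ≤
        pPow p n z * (Real.log m⁻¹ - 1) +
          pPow p n z * e z * (N * m + Real.log (Fintype.card Ω)) := by
      intro z
      have h1 := Real.log_le_sub_one_of_pos (x := (e z * N) / m⁻¹)
        (div_pos (mul_pos (he0 z) hN0) (inv_pos.2 hA))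
      rw [Real.log_div (mul_pos (he0 z) hN0).ne' (inv_pos.2 hA).ne', div_inv_eq_mul] at h1
      have h3 := mul_le_mul_of_nonneg_left h1 (hpn.1 z)
      nlinarith [h3]
    refine (Finset.sum_le_sum fun z _ => hpt z).trans ?_
    rw [Finset.sum_add_distrib, ← Finset.sum_mul, ← Finset.sum_mul, hpn.2]
    have hlc : 0 ≤ Real.log (Fintype.card Ω) := Real.log_nonneg hcard1
    have h5 := mul_le_mul_of_nonneg_right hE
      (by positivity : 0 ≤ N * m + Real.log (Fintype.card Ω))
    have h6 : 1 / (N * m) * (N * m + Real.log (Fintype.card Ω)) =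
        1 + Real.log (Fintype.card Ω) / m * (1 / N) := by
      field_simp
    have h7 : (Real.logb 2 m⁻¹ + Real.logb 2 (Fintype.card Ω) / m * (1 / N)) * Real.log 2 =
        Real.log m⁻¹ + Real.log (Fintype.card Ω) / m * (1 / N) := by
      simp only [Real.logb]; field_simp
    rw [h7]
    linarith
  · rintro (i | ω)
    · refine hmem _ i ?_
      simp only [s, Sum.elim_inl, embedHyp, Finset.mem_filter, Finset.mem_univ, true_and]
      exact ⟨A, hAX, fun _ h => h⟩
    · refine hmem _ i0 ?_
      simp only [s, Sum.elim_inr, embedHyp, Finset.mem_filter, Finset.mem_univ, true_and]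
      split_ifs with h
      · exact ⟨{ω}, h, fun z hz => by simpa using hz⟩
      · exact ⟨A, hAX, fun z hz => by simp at hz⟩
  · rintro z (i | ω)
    · simp only [κ, Sum.elim_inl]; positivity
    · simp only [κ, Sum.elim_inr]; positivity
  · intro z
    rw [Fintype.sum_sum_type]
    simp only [κ, Sum.elim_inl, Sum.elim_inr]
    rw [← Finset.sum_filter, Finset.sum_const, nsmul_eq_mul]
    simp only [Finset.sum_ite_eq, Finset.mem_univ, if_true]
    change (cnt A n z : ℝ) * _ + _ = 1
    field_simp
  · rintro z (i | ω) hz h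
    · simp only [κ, Sum.elim_inl] at h
      simp only [s, Sum.elim_inl, Finset.mem_filter, Finset.mem_univ, true_and]
      by_contra h'
      simp [h'] at h
    · simp only [κ, Sum.elim_inr] at h
      have h' : z i0 = ω := by
        by_contra h'
        simp [h'] at h
      have hpos : 0 < p ω := by
        refine lt_of_le_of_ne (hp.1 ω) fun h0 => ?_
        have : pPow p n z = 0 := Finset.prod_eq_zero (Finset.mem_univ i0) (by rw [h', ← h0])
        rw [this] at hz
        exact lt_irrefl _ hz
      simp [s, hsupp ω hpos, h']
  · rintro (i | ω)
    · simp only [r, Sum.elim_inl]; positivity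
    · simp only [r, Sum.elim_inr]; positivity
  · rw [Fintype.sum_sum_type]
    simp only [r, Sum.elim_inl, Sum.elim_inr, Finset.sum_const, Finset.card_univ,
      Fintype.card_fin, nsmul_eq_mul]
    apply le_of_eq
    field_simp

lemma aux_marg [Fintype Ω] (p : Ω → ℝ) (hp : IsPMF p) (A : Finset Ω) (n : ℕ) (i : Fin n) :
    pset (pPow p n) (Finset.univ.filter fun z => z i ∈ A) = pset p A := by
  have := Finset.prod_univ_sum (fun j : Fin n => if j = i then A else (Finset.univ : Finset Ω))
    (fun _ ω => p ω)
  have h2 : (Fintype.piFinset fun j : Fin n => if j = i then A else (Finset.univ : Finset Ω)) =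
      Finset.univ.filter fun z => z i ∈ A := by
    ext z
    simp only [Fintype.mem_piFinset, Finset.mem_filter, Finset.mem_univ, true_and]
    constructor
    · intro h; simpa using h i
    · intro h j
      by_cases hj : j = i
      · subst hj; simpa using h
      · simp [hj]
  rw [h2] at this
  simp only [pset, pPow]
  rw [← this, Finset.prod_eq_single i]
  · simp
  · intro j _ hj
    simp [hj, hp.2]
  · simp

/-- **Disjunctive source coding theorem.** If `supp(p) ⊆ supp(X)`,
then `lim_n H(∪ᵢ Xᵢ) = H∞(X)` for the `n`-fold i.i.d. hyperconfusion sequence of `X`. -/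
theorem stmt11 [Fintype Ω] (p : Ω → ℝ) (hp : IsPMF p)
    (X : Finset (Finset Ω)) (hX : IsHyp X)
    (hsupp : ∀ ω : Ω, 0 < p ω → ({ω} : Finset Ω) ∈ X) :
    Filter.Tendsto
      (fun n : ℕ =>
        Hent (pPow p n) (Finset.univ.sup fun i : Fin n => embedHyp X n i))
      Filter.atTop (nhds (Hmin p X)) := by
  obtain ⟨A, hAX, hmax⟩ := Finset.exists_max_image X (pset p) hX.1
  have hA : 0 < pset p A := by
    obtain ⟨ω, -, hω⟩ := Finset.exists_lt_of_sum_lt (s := Finset.univ) (f := fun _ : Ω => (0:ℝ))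
      (g := p) (by simp [hp.2])
    have := hmax _ (hsupp ω hω)
    simp only [pset, Finset.sum_singleton] at this
    exact hω.trans_le this
  have hHmin : Hmin p X = ENNReal.ofReal (Real.logb 2 (pset p A)⁻¹) := by
    apply le_antisymm
    · refine (iInf₂_le A hAX).trans ?_
      rw [negLog2, if_neg (not_le.2 hA)]
    · refine le_iInf₂ fun B hB => ?_
      rw [negLog2]
      split_ifs with h
      · exact le_top
      · push Not at h
        apply ENNReal.ofReal_le_ofReal
        have := hmax B hB
        exact Real.logb_le_logb_of_le (by norm_num) (by positivity) (by gcongr)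
  rw [hHmin]
  have hlim : Filter.Tendsto (fun n : ℕ => ENNReal.ofReal (Real.logb 2 (pset p A)⁻¹ +
        Real.logb 2 (Fintype.card Ω) / (pset p A) * (1 / ((n:ℝ) + 1)))) Filter.atTop
      (nhds (ENNReal.ofReal (Real.logb 2 (pset p A)⁻¹))) := by
    apply ENNReal.tendsto_ofReal
    have h := (tendsto_one_div_add_atTop_nhds_zero_nat (𝕜 := ℝ)).const_mul
      (Real.logb 2 (Fintype.card Ω) / (pset p A))
    simpa using h.const_add (Real.logb 2 (pset p A)⁻¹)
  refine tendsto_of_tendsto_of_tendsto_of_le_of_le' tendsto_const_nhds hlim ?_ ?_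
  · refine Filter.Eventually.of_forall fun n => ?_
    refine le_iInf₂ fun k hk => ENNReal.ofReal_le_ofReal ?_
    refine aux_lower (pPow p n) (aux_pPow p hp n) _ (pset p A) hA (fun C hC => ?_) k hk
    obtain ⟨i, -, hi⟩ := Finset.mem_sup.1 hC
    simp only [embedHyp, Finset.mem_filter, Finset.mem_univ, true_and] at hi
    obtain ⟨B, hB, hCB⟩ := hi
    refine le_trans ?_ (hmax B hB)
    rw [← aux_marg p hp B n i]
    exact Finset.sum_le_sum_of_subset_of_nonneg (fun z hz => by simpa using hCB z hz)
      fun z _ _ => (aux_pPow p hp n).1 z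
  · filter_upwards [Filter.eventually_gt_atTop 0] with n hn
    exact aux_main p hp X hX hsupp A hAX hA n hn

end
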